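/- Let N ≥ 3 be an integer, let a, b be reals with 0 < a < (N−2)/2 and a < b < a+1, set d := 1+a−b, 2♯ := 2N/(N−2d), δ_q := ((N−2a+2b)q − 2N)/(2q), q_c := (4+2N)/(N−2a+2b). Let q_c < q < 2♯ (so 2 < qδ_q < 2♯) and β > 0. Then for every u ∈ C_c^∞(ℝ^N), u ≠ 0, the fiber map Φ^u_β(t) := (e^{2t}/2)A(u) − (β e^{qδ_q t}/q)B_q(u) − (e^{2♯ t}/2♯)B_{2♯}(u) has a unique critical point t_* ∈ ℝ, which is its strict global maximum; Φ^u_β(t_*) > 0; Φ^u_β is concave and strictly decreasing on (t_*, ∞); and Φ^u_β′(0) < 0 if and only if t_* < 0. -/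

import Mathlib

open MeasureTheory Real Set Filter Asymptotics

noncomputable section

abbrev E (N : ℕ) := EuclideanSpace ℝ (Fin N)

/-- Weighted gradient integral `∫ |x|^{-2a} |∇u|²`. -/
def Aint (N : ℕ) (a : ℝ) (u : E N → ℝ) : ℝ :=
  ∫ x : E N, ‖x‖ ^ (-(2 * a)) * ‖fderiv ℝ u x‖ ^ 2

/-- Weighted mass `∫ |x|^{-2a} |u|²`. -/
def mint (N : ℕ) (a : ℝ) (u : E N → ℝ) : ℝ :=
  ∫ x : E N, ‖x‖ ^ (-(2 * a)) * (u x) ^ 2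

/-- Weighted `L^s` integral `∫ |x|^{-bs} |u|^s`. -/
def Bint (N : ℕ) (b s : ℝ) (u : E N → ℝ) : ℝ :=
  ∫ x : E N, ‖x‖ ^ (-(b * s)) * |u x| ^ s

/-- A function on `ℝ^N` is radial if it depends only on the norm. -/
def IsRadial {N : ℕ} (u : E N → ℝ) : Prop :=
  ∀ x y : E N, ‖x‖ = ‖y‖ → u x = u y

/-- The best Caffarelli–Kohn–Nirenberg constant `S(a,b)` (with critical exponent `p = 2♯`). -/
def Sab (N : ℕ) (a b p : ℝ) : ℝ :=
  sInf {r : ℝ | ∃ u : E N → ℝ, ContDiff ℝ (⊤ : ℕ∞) u ∧ HasCompactSupport u ∧ u ≠ 0 ∧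
    r = Aint N a u / (Bint N b p u) ^ (2 / p)}

/-- A singular weight `‖x‖^(-s)`, `s < N`, times a nonnegative nonzero continuous function with
compact support has positive integral. -/
lemma integral_norm_rpow_neg_mul_pos {N : ℕ} (hN : 1 ≤ N) {s : ℝ} (hs : s < N) {g : E N → ℝ}
    (hg : Continuous g) (hgs : HasCompactSupport g) (hg0 : 0 ≤ g) (hne : g ≠ 0) :
    0 < ∫ x : E N, ‖x‖ ^ (-s) * g x := by
  have hfin : Module.finrank ℝ (E N) = N := by simp
  have : Nontrivial (E N) := Module.nontrivial_of_finrank_pos (R := ℝ) (by rw [hfin]; lia)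
  have hloc : LocallyIntegrable (fun x : E N => ‖x‖ ^ (-s)) volume := by
    refine locallyIntegrable_of_norm_le_rpow (C := 1) (α := s) (by rw [hfin]; exact hN)
      (by rw [hfin]; exact hs) (ae_of_all _ fun x => ?_)
      (measurable_norm.pow_const _).aestronglyMeasurable
    rw [one_mul, norm_of_nonneg (by positivity)]
  have hint : Integrable (fun x : E N => ‖x‖ ^ (-s) * g x) volume :=
    hloc.integrable_smul_right_of_hasCompactSupport hg hgs
  rw [integral_pos_iff_support_of_nonneg (fun x => mul_nonneg (by positivity) (hg0 x)) hint]
  have hsub : Function.support g \ {0} ⊆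
      Function.support (fun x : E N => ‖x‖ ^ (-s) * g x) := by
    rintro x ⟨hx, hx0⟩
    exact mul_ne_zero (rpow_pos_of_pos (norm_pos_iff.2 hx0) _).ne' hx
  refine lt_of_lt_of_le ?_ (measure_mono hsub)
  rw [measure_sdiff_null (measure_singleton _)]
  exact hg.isOpen_support.measure_pos _ (Function.support_nonempty_iff.2 hne)

lemma Bint_pos {N : ℕ} (hN : 1 ≤ N) {b s : ℝ} (hs : 0 < s) (hbs : b * s < N) {u : E N → ℝ}
    (hu : Continuous u) (hus : HasCompactSupport u) (hne : u ≠ 0) : 0 < Bint N b s u := by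
  refine integral_norm_rpow_neg_mul_pos hN hbs (hu.abs.rpow_const fun _ => Or.inr hs.le)
    (hus.comp_left (g := fun y : ℝ => |y| ^ s) (by simp [hs.ne']))
    (fun x => by positivity) fun h => hne ?_
  ext x
  have hx : |u x| ^ s = 0 := congrFun h x
  simpa using (rpow_eq_zero (abs_nonneg _) hs.ne').1 hx

lemma Aint_pos {N : ℕ} (hN : 1 ≤ N) {a : ℝ} (ha : 2 * a < N) {u : E N → ℝ}
    (hu : ContDiff ℝ 1 u) (hus : HasCompactSupport u) (hne : u ≠ 0) : 0 < Aint N a u := by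
  have hfin : Module.finrank ℝ (E N) = N := by simp
  have : Nontrivial (E N) := Module.nontrivial_of_finrank_pos (R := ℝ) (by rw [hfin]; lia)
  refine integral_norm_rpow_neg_mul_pos hN ha ((hu.continuous_fderiv one_ne_zero).norm.pow 2)
    ((hus.fderiv (𝕜 := ℝ)).comp_left (g := fun y => ‖y‖ ^ 2) (by simp))
    (fun x => by positivity) fun h => hne ?_
  have hd : ∀ x, fderiv ℝ u x = 0 := fun x => by
    have hx : ‖fderiv ℝ u x‖ ^ 2 = 0 := congrFun h x
    simpa using hx
  have : NoncompactSpace (E N) := NormedSpace.noncompactSpace ℝ (E N)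
  obtain ⟨y, hy⟩ : ∃ y, y ∉ tsupport u := by
    by_contra! hall
    exact noncompact_univ (E N) ((eq_univ_of_forall hall) ▸ hus.isCompact)
  ext x
  rw [is_const_of_fderiv_eq_zero (𝕜 := ℝ) (hu.differentiable one_ne_zero) hd x y]
  exact image_eq_zero_of_notMem_tsupport hy

/-- For positive coefficients and exponents, `A - B e^{rt} - C e^{pt}` has a zero. -/
lemma exists_zero_of_const_sub_exp {A B C r p : ℝ} (hA : 0 < A) (hB : 0 < B) (hC : 0 < C)
    (hr : 0 < r) (hp : 0 < p) :
    ∃ t, A - B * exp (r * t) - C * exp (p * t) = 0 := by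
  have hlim : ∀ {k : ℝ}, 0 < k → Tendsto (fun t : ℝ => exp (k * t)) atBot (nhds 0) :=
    fun hk => tendsto_exp_atBot.comp (tendsto_id.const_mul_atBot hk)
  have hbot : Tendsto (fun t : ℝ => A - B * exp (r * t) - C * exp (p * t)) atBot (nhds A) := by
    simpa using (((hlim hr).const_mul B).const_sub A).sub ((hlim hp).const_mul C)
  obtain ⟨t₀, ht₀⟩ := (hbot.eventually (lt_mem_nhds hA)).exists
  have hneg : A - B * exp (r * (log (A / B) / r)) - C * exp (p * (log (A / B) / r)) ≤ 0 := by
    rw [mul_div_cancel₀ _ hr.ne', exp_log (by positivity), mul_div_cancel₀ _ hB.ne', sub_self]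
    have := exp_pos (p * (log (A / B) / r))
    nlinarith
  exact mem_range_of_exists_le_of_exists_ge (by fun_prop) ⟨_, hneg⟩ ⟨t₀, ht₀.le⟩

/-- The graph of `(A/2) e^{2t} - (B/r) e^{rt} - (C/p) e^{pt}` for exponents `r, p > 2`. -/
lemma fiber_geometry {A B C r p : ℝ} (hA : 0 < A) (hB : 0 < B) (hC : 0 < C)
    (hr : 2 < r) (hp : 2 < p) {Φ : ℝ → ℝ}
    (hΦ : ∀ t, Φ t = exp (2 * t) / 2 * A - exp (r * t) / r * B - exp (p * t) / p * C) :
    ∃ tstar : ℝ,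
      deriv Φ tstar = 0 ∧
      (∀ t : ℝ, deriv Φ t = 0 → t = tstar) ∧
      (∀ t : ℝ, t ≠ tstar → Φ t < Φ tstar) ∧
      0 < Φ tstar ∧
      ConcaveOn ℝ (Ioi tstar) Φ ∧
      StrictAntiOn Φ (Ioi tstar) ∧
      (deriv Φ 0 < 0 ↔ tstar < 0) := by
  obtain ⟨h, hh⟩ : ∃ h : ℝ → ℝ,
      ∀ t, h t = A - B * exp ((r - 2) * t) - C * exp ((p - 2) * t) := ⟨_, fun _ => rfl⟩
  have hexp : ∀ k t : ℝ, exp (k * t) = exp (2 * t) * exp ((k - 2) * t) := fun k t => by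
    rw [← exp_add]; ring_nf
  have hderiv : ∀ t, HasDerivAt Φ (exp (2 * t) * h t) t := fun t => by
    have hE : ∀ k : ℝ, HasDerivAt (fun t : ℝ => exp (k * t)) (exp (k * t) * k) t := fun k => by
      simpa using ((hasDerivAt_id t).const_mul k).exp
    have := ((((hE 2).div_const 2).mul_const A).sub (((hE r).div_const r).mul_const B)).sub
      (((hE p).div_const p).mul_const C)
    rw [funext hΦ]
    refine this.congr_deriv ?_
    rw [hh, hexp r, hexp p]
    field_simp
  have hD : ∀ t, deriv Φ t = exp (2 * t) * h t := fun t => (hderiv t).deriv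
  have hanti : StrictAnti h := fun s t hst => by
    rw [hh, hh]
    have h1 : exp ((r - 2) * s) < exp ((r - 2) * t) := exp_lt_exp.2 (by nlinarith)
    have h2 : exp ((p - 2) * s) < exp ((p - 2) * t) := exp_lt_exp.2 (by nlinarith)
    nlinarith
  obtain ⟨τ, hτ⟩ := exists_zero_of_const_sub_exp hA hB hC (sub_pos.2 hr) (sub_pos.2 hp)
  have hτ0 : h τ = 0 := (hh τ).trans hτ
  have hcont : Continuous Φ := continuous_iff_continuousAt.2 fun t => (hderiv t).continuousAt
  have hdec : StrictAntiOn Φ (Ici τ) := by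
    refine strictAntiOn_of_deriv_neg (convex_Ici τ) hcont.continuousOn fun t ht => ?_
    rw [interior_Ici] at ht
    rw [hD]
    exact mul_neg_of_pos_of_neg (exp_pos _) (hτ0 ▸ hanti ht)
  have hinc : StrictMonoOn Φ (Iic τ) := by
    refine strictMonoOn_of_deriv_pos (convex_Iic τ) hcont.continuousOn fun t ht => ?_
    rw [interior_Iic] at ht
    rw [hD]
    exact mul_pos (exp_pos _) (hτ0 ▸ hanti ht)
  refine ⟨τ, by rw [hD, hτ0, mul_zero], fun t ht => ?_, fun t ht => ?_, ?_, ?_,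
    hdec.mono Ioi_subset_Ici_self, ?_⟩
  · rw [hD] at ht
    exact hanti.injective (((mul_eq_zero.1 ht).resolve_left (exp_pos _).ne').trans hτ0.symm)
  · rcases ht.lt_or_gt with ht | ht
    · exact hinc ht.le self_mem_Iic ht
    · exact hdec self_mem_Ici ht.le ht
  · have hval : Φ τ = exp (2 * τ) * (B * exp ((r - 2) * τ) * (1 / 2 - 1 / r)
        + C * exp ((p - 2) * τ) * (1 / 2 - 1 / p)) := by
      have hAeq : A = B * exp ((r - 2) * τ) + C * exp ((p - 2) * τ) := by linarith
      rw [hΦ, hexp r, hexp p]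
      nth_rewrite 1 [hAeq]
      ring
    have h1 : 0 < 1 / 2 - 1 / r := sub_pos.2 (one_div_lt_one_div_of_lt two_pos hr)
    have h2 : 0 < 1 / 2 - 1 / p := sub_pos.2 (one_div_lt_one_div_of_lt two_pos hp)
    rw [hval]
    positivity
  · refine AntitoneOn.concaveOn_of_deriv (convex_Ioi τ) hcont.continuousOn
      (fun t _ => (hderiv t).differentiableAt.differentiableWithinAt) ?_
    rw [interior_Ioi]
    intro s hs t _ hst
    have h1 : h t ≤ h s := hanti.antitone hst
    have h2 : h s < 0 := hτ0 ▸ hanti hs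
    have h3 : exp (2 * s) ≤ exp (2 * t) := exp_le_exp.2 (by linarith)
    rw [hD, hD]
    nlinarith [exp_pos (2 * s), exp_pos (2 * t)]
  · rw [hD, mul_zero, exp_zero, one_mul, ← hτ0]
    exact hanti.lt_iff_gt

/-- Lemma 6.2 (mass-supercritical fiber-map geometry): for `q_c < q < 2♯` and `β > 0`, the
fiber map of any nonzero test function has a unique critical point `t_*`, which is a strict
global maximum at a positive level; the fiber map is concave and strictly decreasing on
`(t_*, ∞)`, and `Φ'(0) < 0` iff `t_* < 0`. -/
theorem supercritical_fiber_geometry (N : ℕ) (hN : 3 ≤ N) (a b d p q qc δ β : ℝ)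
    (ha : 0 < a) (ha' : a < ((N : ℝ) - 2) / 2) (hab : a < b) (hb : b < a + 1)
    (hd : d = 1 + a - b) (hp : p = 2 * N / ((N : ℝ) - 2 * d))
    (hδ : δ = (((N : ℝ) - 2 * a + 2 * b) * q - 2 * N) / (2 * q))
    (hqc : qc = (4 + 2 * N) / ((N : ℝ) - 2 * a + 2 * b))
    (hq : qc < q) (hq' : q < p) (hβ : 0 < β) :
    ∀ u : E N → ℝ, ContDiff ℝ (⊤ : ℕ∞) u → HasCompactSupport u → u ≠ 0 →
      ∀ Φ : ℝ → ℝ, (∀ t : ℝ, Φ t = Real.exp (2 * t) / 2 * Aint N a u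
        - β * Real.exp (q * δ * t) / q * Bint N b q u
        - Real.exp (p * t) / p * Bint N b p u) →
      ∃ tstar : ℝ,
        deriv Φ tstar = 0 ∧
        (∀ t : ℝ, deriv Φ t = 0 → t = tstar) ∧
        (∀ t : ℝ, t ≠ tstar → Φ t < Φ tstar) ∧
        0 < Φ tstar ∧
        ConcaveOn ℝ (Ioi tstar) Φ ∧
        StrictAntiOn Φ (Ioi tstar) ∧
        (deriv Φ 0 < 0 ↔ tstar < 0) := by
  intro u hu hus hne Φ hΦ
  have hN3 : (3 : ℝ) ≤ N := by exact_mod_cast hN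
  have hN1 : 1 ≤ N := by lia
  have hden : 0 < (N : ℝ) - 2 * d := by linarith
  have hM : 0 < (N : ℝ) - 2 * a + 2 * b := by linarith
  have hp2 : 2 < p := by rw [hp, lt_div_iff₀ hden]; linarith
  have hq0 : 0 < q := lt_trans (by rw [hqc]; positivity) hq
  have hqδ : q * δ = (((N : ℝ) - 2 * a + 2 * b) * q - 2 * N) / 2 := by rw [hδ]; field_simp
  have hr : 2 < q * δ := by
    rw [hqc, div_lt_iff₀ hM] at hq
    rw [hqδ]
    linarith
  have hδ0 : 0 < δ := pos_of_mul_pos_right (by linarith) hq0.le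
  have hbp : b * p < N := by
    rw [hp, mul_div_assoc', div_lt_iff₀ hden]
    nlinarith
  have hbq : b * q < N := (mul_lt_mul_of_pos_left hq' (by linarith)).trans hbp
  have hA := Aint_pos hN1 (a := a) (by linarith) (hu.of_le (by exact_mod_cast le_top)) hus hne
  have hB := Bint_pos hN1 hq0 hbq hu.continuous hus hne
  have hC := Bint_pos hN1 (by linarith) hbp hu.continuous hus hne
  refine fiber_geometry (B := β * δ * Bint N b q u) hA (by positivity) hC hr hp2 fun t => ?_
  rw [hΦ]
  field_simp
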